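/- Consider realizations of sparse ReLU networks R(d,W,L,B,s). (i) There exists an absolute constant C ∈ ℝ_+ such that for every p ∈ [1,∞], all d, W, L, s ∈ ℕ with W ≥ d and s ≥ max{W,L}, every B ∈ ℝ_+ with B ≥ 1, and every ε ∈ (0,1/2), log N(ε, R(d,W,L,B,s), L^p([0,1]^d)) ≤ C · min{s, W²L} · log((W+1)^L B^L / ε). (ii) There exist absolute constants c, D ∈ ℝ_+ such that if, in addition, W, L ≥ 60 and s ≥ D d² L, then for every ε ∈ (0,1/4), log N(ε, R(d,W,L,B,s), L^p([0,1]^d)) ≥ c · min{s, W²L} · log((W̃+1)^L B^L / ε), where W̃ = min{⌈√(s/L)⌉, W}. -/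

import Mathlib

open MeasureTheory ProbabilityTheory ENNReal

noncomputable section

/-- A ReLU network configuration with input dimension `d`:
a finite sequence of matrix–vector pairs `(A_i, b_i)`, `i = 0, …, depth − 1`. -/
structure ReLUNet (d : ℕ) where
  depth : ℕ
  depth_pos : 0 < depth
  width : ℕ → ℕ
  width_in : width 0 = d
  width_out : width depth = 1
  A : ∀ i : ℕ, Matrix (Fin (width (i + 1))) (Fin (width i)) ℝ
  b : ∀ i : ℕ, Fin (width (i + 1)) → ℝ

namespace ReLUNet

variable {d : ℕ}

/-- The affine map `x ↦ A_i x + b_i` of layer `i`. -/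
def layer (Φ : ReLUNet d) (i : ℕ) (x : Fin (Φ.width i) → ℝ) :
    Fin (Φ.width (i + 1)) → ℝ :=
  fun j => (∑ k, Φ.A i j k * x k) + Φ.b i j

/-- Output after the first `i` affine layers, with the ReLU activation `ρ(x) = max{x,0}`
applied between consecutive affine layers (not on the input and not after the last
affine layer). -/
def forward (Φ : ReLUNet d) : (i : ℕ) → (Fin (Φ.width 0) → ℝ) → Fin (Φ.width i) → ℝ
  | 0, x => x
  | i + 1, x =>
      Φ.layer i fun k => if i = 0 then Φ.forward i x k else max (Φ.forward i x k) 0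

/-- The realization `R(Φ) : ℝ^d → ℝ` of a network configuration. -/
def realization (Φ : ReLUNet d) (x : Fin d → ℝ) : ℝ :=
  Φ.forward Φ.depth (fun k => x (Fin.cast Φ.width_in k)) (Fin.cast Φ.width_out.symm 0)

/-- All layer widths are at most `W`. -/
def widthLe (Φ : ReLUNet d) (W : ℕ) : Prop :=
  ∀ i ≤ Φ.depth, Φ.width i ≤ W

/-- All weights have absolute value at most `B`. -/
def magLe (Φ : ReLUNet d) (B : ℝ) : Prop :=
  ∀ i < Φ.depth, (∀ j k, |Φ.A i j k| ≤ B) ∧ ∀ j, |Φ.b i j| ≤ B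

/-- All weights take values in the set `𝔸`. -/
def coefIn (Φ : ReLUNet d) (𝔸 : Set ℝ) : Prop :=
  ∀ i < Φ.depth, (∀ j k, Φ.A i j k ∈ 𝔸) ∧ ∀ j, Φ.b i j ∈ 𝔸

open Classical in
/-- The connectivity (total number of nonzero weights) of a network configuration. -/
def connectivity (Φ : ReLUNet d) : ℕ :=
  ∑ i ∈ Finset.range Φ.depth,
    ((Finset.univ.filter fun jk : Fin (Φ.width (i + 1)) × Fin (Φ.width i) =>
        Φ.A i jk.1 jk.2 ≠ 0).card
      + (Finset.univ.filter fun j : Fin (Φ.width (i + 1)) => Φ.b i j ≠ 0).card)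

end ReLUNet

/-- `R(d,W,L,B)`: realizations of ReLU networks with input dimension `d`, output
dimension 1, width at most `W`, depth at most `L`, and weight magnitude at most `B`. -/
def RclassB (d W L : ℕ) (B : ℝ) : Set ((Fin d → ℝ) → ℝ) :=
  {f | ∃ Φ : ReLUNet d, Φ.widthLe W ∧ Φ.depth ≤ L ∧ Φ.magLe B ∧ Φ.realization = f}

/-- `R(d,W,L)`: realizations with width at most `W` and depth at most `L`,
with no constraint on the weight magnitude. -/
def Rclass (d W L : ℕ) : Set ((Fin d → ℝ) → ℝ) :=
  {f | ∃ Φ : ReLUNet d, Φ.widthLe W ∧ Φ.depth ≤ L ∧ Φ.realization = f}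

/-- `R_𝔸(d,W,L)`: realizations with width at most `W`, depth at most `L`, and all
weights taking values in `𝔸`. -/
def RclassCoef (d W L : ℕ) (𝔸 : Set ℝ) : Set ((Fin d → ℝ) → ℝ) :=
  {f | ∃ Φ : ReLUNet d, Φ.widthLe W ∧ Φ.depth ≤ L ∧ Φ.coefIn 𝔸 ∧ Φ.realization = f}

/-- `R(d,W,L,B,s)`: realizations with width ≤ `W`, depth ≤ `L`, weight magnitude ≤ `B`,
and connectivity ≤ `s`. -/
def RclassSparse (d W L : ℕ) (B : ℝ) (s : ℕ) : Set ((Fin d → ℝ) → ℝ) :=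
  {f | ∃ Φ : ReLUNet d, Φ.widthLe W ∧ Φ.depth ≤ L ∧ Φ.magLe B ∧
    Φ.connectivity ≤ s ∧ Φ.realization = f}

/-- The unit cube `[0,1]^d`. -/
def unitCube (d : ℕ) : Set (Fin d → ℝ) := Set.univ.pi fun _ => Set.Icc (0 : ℝ) 1

/-- The `L^p([0,1]^d)` distance between two functions on `ℝ^d` (with `p = ⊤`
corresponding to `L^∞`). -/
def cubeDist (d : ℕ) (p : ℝ≥0∞) (f g : (Fin d → ℝ) → ℝ) : ℝ≥0∞ :=
  eLpNorm (f - g) p (volume.restrict (unitCube d))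

/-- The `L^p([0,1])` distance between two functions on `ℝ`. -/
def intervalDist (p : ℝ≥0∞) (f g : ℝ → ℝ) : ℝ≥0∞ :=
  eLpNorm (f - g) p (volume.restrict (Set.Icc (0 : ℝ) 1))

/-- The `ε`-covering number of `X` with respect to the extended distance `δ`:
the cardinality of a smallest subset `C ⊆ X` such that every point of `X` is within
distance `ε` of some point of `C` (equal to `⊤` if no finite covering exists). -/
def coveringNumber {α : Type*} (ε : ℝ≥0∞) (X : Set α) (δ : α → α → ℝ≥0∞) : ℕ∞ :=
  sInf {n : ℕ∞ | ∃ C : Finset α, ↑C ⊆ X ∧ (∀ x ∈ X, ∃ c ∈ C, δ x c ≤ ε) ∧ (C.card : ℕ∞) = n}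

/-- The `ε`-packing number of `X` with respect to the extended distance `δ`:
the cardinality of a largest subset of `X` whose points have pairwise distances `> ε`. -/
def packingNumber {α : Type*} (ε : ℝ≥0∞) (X : Set α) (δ : α → α → ℝ≥0∞) : ℕ∞ :=
  sSup {n : ℕ∞ | ∃ C : Finset α, ↑C ⊆ X ∧
    (∀ x ∈ C, ∀ y ∈ C, x ≠ y → ε < δ x y) ∧ (C.card : ℕ∞) = n}

/-- Base-2 logarithm of an extended natural number, valued in `ℝ≥0∞`. -/
def elog2 (n : ℕ∞) : ℝ≥0∞ :=
  if n = ⊤ then ⊤ else ENNReal.ofReal (Real.logb 2 (n.toNat : ℝ))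

/-- The minimax approximation error `A(G, F, δ) = sup_{g ∈ G} inf_{f ∈ F} δ(f, g)`. -/
def minimaxErr {α : Type*} (G F : Set α) (δ : α → α → ℝ≥0∞) : ℝ≥0∞ :=
  ⨆ g ∈ G, ⨅ f ∈ F, δ f g

/-- The affine outputs of a network whose weights are given by families indexed by natural
numbers; `w i` is the width of layer `i`. -/
def flatEval {d : ℕ} (w : ℕ → ℕ) (a : ℕ → ℕ → ℕ → ℝ) (b : ℕ → ℕ → ℝ) (x : Fin d → ℝ) :
    ℕ → ℕ → ℝ
  | 0, k => if h : k < d then x ⟨k, h⟩ else 0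
  | i + 1, j =>
      (∑ k ∈ Finset.range (w i), a i j k *
        (if i = 0 then flatEval w a b x i k else max (flatEval w a b x i k) 0)) + b i j

lemma flatEval_congr {d : ℕ} {w w' : ℕ → ℕ} {a a' : ℕ → ℕ → ℕ → ℝ} {b b' : ℕ → ℕ → ℝ}
    (x : Fin d → ℝ) (i : ℕ) (h : ∀ l < i, w l = w' l ∧ a l = a' l ∧ b l = b' l) (k : ℕ) :
    flatEval w a b x i k = flatEval w' a' b' x i k := by
  induction i generalizing k with
  | zero => rfl
  | succ i ih =>
    obtain ⟨h1, h2, h3⟩ := h i (Nat.lt_succ_self i)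
    simp only [flatEval, h1, h2, h3, fun k => ih (fun l hl => h l (by omega)) k]

/-- A network with padded weights has the same outputs. -/
lemma ReLUNet.forward_eq_flatEval {d : ℕ} (Φ : ReLUNet d) {w : ℕ → ℕ} {a : ℕ → ℕ → ℕ → ℝ}
    {b : ℕ → ℕ → ℝ} (hw : ∀ i < Φ.depth, Φ.width i ≤ w i)
    (ha : ∀ i < Φ.depth, ∀ (j : Fin (Φ.width (i + 1))) (k : Fin (Φ.width i)),
      a i j k = Φ.A i j k)
    (ha0 : ∀ i < Φ.depth, ∀ j k, Φ.width i ≤ k → k < w i → a i j k = 0)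
    (hb : ∀ i < Φ.depth, ∀ j : Fin (Φ.width (i + 1)), b i j = Φ.b i j)
    (x : Fin d → ℝ) (i : ℕ) (hi : i ≤ Φ.depth) (k : Fin (Φ.width i)) :
    Φ.forward i (fun k => x (Fin.cast Φ.width_in k)) k = flatEval w a b x i k := by
  induction i with
  | zero =>
    have hk : (k : ℕ) < d := k.2.trans_eq Φ.width_in
    simp only [forward, flatEval, hk, dif_pos]
    rfl
  | succ i ih =>
    have hi' : i < Φ.depth := hi
    simp only [forward, layer, flatEval]
    rw [hb i hi', ← Finset.sum_subset (Finset.range_subset_range.2 (hw i hi')), Finset.sum_range]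
    · congr 1
      refine Finset.sum_congr rfl fun l _ => ?_
      rw [ha i hi', ← ih hi'.le l]
    · intro l hl hl'
      rw [ha0 i hi' _ _ (by simpa using hl') (by simpa using hl), zero_mul]

lemma ReLUNet.continuous_forward {d : ℕ} (Φ : ReLUNet d) (i : ℕ) :
    Continuous fun x => Φ.forward i x := by
  induction i with
  | zero => exact continuous_id
  | succ i ih =>
    refine continuous_pi fun j => ?_
    have h : ∀ k, Continuous fun x => Φ.forward i x k := fun k => (continuous_apply k).comp ih
    simp only [forward, layer]
    refine (continuous_finsetSum _ fun k _ => continuous_const.mul ?_).add continuous_const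
    split_ifs
    · exact h k
    · exact (h k).max continuous_const

lemma ReLUNet.continuous_realization {d : ℕ} (Φ : ReLUNet d) : Continuous Φ.realization :=
  (continuous_apply _).comp ((Φ.continuous_forward Φ.depth).comp
    (continuous_pi fun k => continuous_apply (Fin.cast Φ.width_in k)))

/-- Transforming every weight by `q`. -/
abbrev ReLUNet.mapWeights {d : ℕ} (Φ : ReLUNet d) (q : ℝ → ℝ) : ReLUNet d :=
  { Φ with
    A := fun i j k => q (Φ.A i j k)
    b := fun i j => q (Φ.b i j) }

lemma ReLUNet.connectivity_mapWeights_le {d : ℕ} (Φ : ReLUNet d) {q : ℝ → ℝ} (hq : q 0 = 0) :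
    (Φ.mapWeights q).connectivity ≤ Φ.connectivity := by
  classical
  unfold connectivity
  refine Finset.sum_le_sum fun i _ => add_le_add ?_ ?_ <;>
  · refine Finset.card_le_card fun j hj => ?_
    rw [Finset.mem_filter] at hj ⊢
    exact ⟨Finset.mem_univ _, fun h => hj.2 ((congrArg q h).trans hq)⟩

lemma max_zero_abs_le (x : ℝ) : |max x 0| ≤ |x| := by
  simpa using abs_max_sub_max_le_abs x 0 0

/-- Growth of the layer outputs on the cube and their sensitivity to a change of the weights. -/
lemma ReLUNet.forward_bounds {d W : ℕ} {B δ : ℝ} (Φ : ReLUNet d) (q : ℝ → ℝ) (hB : 1 ≤ B)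
    (hδ : 0 ≤ δ) (hW : Φ.widthLe W) (hm : Φ.magLe B)
    (hq : ∀ v, |v| ≤ B → |v - q v| ≤ δ ∧ |q v| ≤ |v|)
    (x : Fin (Φ.width 0) → ℝ) (hx : ∀ k, |x k| ≤ 1) (i : ℕ) (hi : i ≤ Φ.depth) :
    (∀ k, |Φ.forward i x k| ≤ (((W : ℝ) + 1) * B) ^ i) ∧
    ∀ k, |Φ.forward i x k - (Φ.mapWeights q).forward i x k|
      ≤ i * δ * (((W : ℝ) + 1) * B) ^ i := by
  have hW0 : (0 : ℝ) ≤ W := Nat.cast_nonneg W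
  have hT : 1 ≤ ((W : ℝ) + 1) * B := by nlinarith
  induction i with
  | zero => exact ⟨fun k => by simpa [forward] using hx k, fun k => by simp [forward]⟩
  | succ i ih =>
    obtain ⟨ih1, ih2⟩ := ih (by omega)
    obtain ⟨hA, hb⟩ := hm i hi
    set T := ((W : ℝ) + 1) * B with hTdef
    have hTi : 1 ≤ T ^ i := one_le_pow₀ hT
    have hwi : ((Φ.width i : ℕ) : ℝ) ≤ W := by exact_mod_cast hW i (by omega)
    set y : Fin (Φ.width i) → ℝ :=
      fun k => if i = 0 then Φ.forward i x k else max (Φ.forward i x k) 0 with hy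
    set y' : Fin (Φ.width i) → ℝ :=
      fun k => if i = 0 then (Φ.mapWeights q).forward i x k
        else max ((Φ.mapWeights q).forward i x k) 0 with hy'
    have y1 : ∀ k, |y k| ≤ T ^ i := fun k => by
      simp only [hy]; split_ifs
      · exact ih1 k
      · exact (max_zero_abs_le _).trans (ih1 k)
    have y2 : ∀ k, |y k - y' k| ≤ i * δ * T ^ i := fun k => by
      simp only [hy, hy']; split_ifs
      · exact ih2 k
      · exact (abs_max_sub_max_le_abs _ _ _).trans (ih2 k)
    have e1 : ∀ j, Φ.forward (i + 1) x j = (∑ k, Φ.A i j k * y k) + Φ.b i j := fun j => rfl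
    have e2 : ∀ j : Fin (Φ.width (i + 1)), (Φ.mapWeights q).forward (i + 1) x j
      = (∑ k, q (Φ.A i j k) * y' k) + q (Φ.b i j) := fun j => rfl
    constructor
    · intro j
      rw [e1]
      have h1 : |∑ k, Φ.A i j k * y k| ≤ W * (B * T ^ i) := by
        refine (Finset.abs_sum_le_sum_abs _ _).trans ?_
        refine (Finset.sum_le_card_nsmul _ _ (B * T ^ i) fun k _ => ?_).trans ?_
        · rw [abs_mul]
          exact mul_le_mul (hA j k) (y1 k) (abs_nonneg _) (by linarith)
        · rw [nsmul_eq_mul, Finset.card_univ, Fintype.card_fin]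
          exact mul_le_mul_of_nonneg_right hwi (by positivity)
      calc _ ≤ |∑ k, Φ.A i j k * y k| + |Φ.b i j| := abs_add_le _ _
        _ ≤ W * (B * T ^ i) + B := add_le_add h1 (hb j)
        _ ≤ W * (B * T ^ i) + B * T ^ i := by nlinarith
        _ = T ^ (i + 1) := by rw [pow_succ]; simp only [hTdef]; ring
    · intro j
      refine le_of_eq_of_le (congrArg abs (congrArg₂ (· - ·) (e1 j) (e2 j))) ?_
      have h1 : |∑ k, (Φ.A i j k * y k - q (Φ.A i j k) * y' k)|
          ≤ W * (δ * T ^ i + B * (i * δ * T ^ i)) := by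
        refine (Finset.abs_sum_le_sum_abs _ _).trans ?_
        refine (Finset.sum_le_card_nsmul _ _ (δ * T ^ i + B * (i * δ * T ^ i))
          fun k _ => ?_).trans ?_
        · have : Φ.A i j k * y k - q (Φ.A i j k) * y' k
            = (Φ.A i j k - q (Φ.A i j k)) * y k + q (Φ.A i j k) * (y k - y' k) := by ring
          rw [this]
          refine (abs_add_le _ _).trans ?_
          rw [abs_mul, abs_mul]
          exact add_le_add
            (mul_le_mul (hq _ (hA j k)).1 (y1 k) (abs_nonneg _) hδ)
            (mul_le_mul ((hq _ (hA j k)).2.trans (hA j k)) (y2 k) (abs_nonneg _) (by linarith))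
        · rw [nsmul_eq_mul, Finset.card_univ, Fintype.card_fin]
          exact mul_le_mul_of_nonneg_right hwi (by positivity)
      have h2 : (∑ k, Φ.A i j k * y k) + Φ.b i j - ((∑ k, q (Φ.A i j k) * y' k) + q (Φ.b i j))
          = (∑ k, (Φ.A i j k * y k - q (Φ.A i j k) * y' k)) + (Φ.b i j - q (Φ.b i j)) := by
        rw [Finset.sum_sub_distrib]; ring
      rw [h2]
      refine (abs_add_le _ _).trans ((add_le_add h1 (hq _ (hb j)).1).trans ?_)
      have hX : 0 ≤ δ * T ^ i := by positivity
      have hδX : δ ≤ δ * T ^ i := le_mul_of_one_le_right hδ hTi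
      have hiX : (0 : ℝ) ≤ i * (δ * T ^ i) := by positivity
      calc _ ≤ W * (δ * T ^ i + B * (i * δ * T ^ i)) + δ * T ^ i := by linarith
        _ ≤ ((W : ℝ) + 1) * (δ * T ^ i) * B + B * (W * (i * (δ * T ^ i)))
            + B * (i * (δ * T ^ i)) := by
          have : ((W : ℝ) + 1) * (δ * T ^ i) ≤ ((W : ℝ) + 1) * (δ * T ^ i) * B :=
            le_mul_of_one_le_right (by positivity) hB
          have : 0 ≤ B * (i * (δ * T ^ i)) := by positivity
          linarith
        _ = _ := by rw [pow_succ]; push_cast; simp only [hTdef]; ring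

/-- Rounding towards zero to the grid `δ ℤ ∩ [-δ Q, δ Q]`. -/
lemma exists_grid_approx {B δ : ℝ} (hδ : 0 < δ) (v : ℝ) (hv : |v| ≤ B) :
    ∃ c : Fin (2 * ⌊B / δ⌋₊ + 1),
      |v - δ * ((c : ℝ) - ⌊B / δ⌋₊)| ≤ δ ∧ |δ * ((c : ℝ) - ⌊B / δ⌋₊)| ≤ |v| := by
  have hn : ⌊|v| / δ⌋₊ ≤ ⌊B / δ⌋₊ := Nat.floor_le_floor (by gcongr)
  have h1 : (⌊|v| / δ⌋₊ : ℝ) * δ ≤ |v| := (le_div_iff₀ hδ).1 (Nat.floor_le (by positivity))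
  have h2 : |v| < ((⌊|v| / δ⌋₊ : ℝ) + 1) * δ := (div_lt_iff₀ hδ).1 (Nat.lt_floor_add_one _)
  have h0 : 0 ≤ (⌊|v| / δ⌋₊ : ℝ) * δ := by positivity
  rcases le_total 0 v with h | h
  · refine ⟨⟨⌊B / δ⌋₊ + ⌊|v| / δ⌋₊, by omega⟩, ?_⟩
    have : δ * ((⌊B / δ⌋₊ + ⌊|v| / δ⌋₊ : ℕ) - (⌊B / δ⌋₊ : ℝ)) = ⌊|v| / δ⌋₊ * δ := by
      push_cast; ring
    simp only [this]
    rw [abs_of_nonneg h] at *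
    exact ⟨abs_le.2 ⟨by linarith, by linarith⟩, by rwa [abs_of_nonneg h0]⟩
  · refine ⟨⟨⌊B / δ⌋₊ - ⌊|v| / δ⌋₊, by omega⟩, ?_⟩
    have : δ * ((⌊B / δ⌋₊ - ⌊|v| / δ⌋₊ : ℕ) - (⌊B / δ⌋₊ : ℝ)) = -(⌊|v| / δ⌋₊ * δ) := by
      rw [Nat.cast_sub hn]; ring
    simp only [this]
    rw [abs_of_nonpos h] at *
    exact ⟨abs_le.2 ⟨by linarith, by linarith⟩, by rwa [abs_neg, abs_of_nonneg h0]⟩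

open Classical in
/-- The function taking the listed values at the listed points and `0` elsewhere. -/
def sparseFun {ι β : Type*} {S : ℕ} (val : β → ℝ) (g : Fin S → ι × β) (i : ι) : ℝ :=
  if h : ∃ t, (g t).1 = i then val (g h.choose).2 else 0

lemma exists_sparseFun_eq {ι β : Type*} [Fintype ι] {S : ℕ} (hS : S ≤ Fintype.card ι)
    (val : β → ℝ) (f : ι → ℝ) (hf : ∀ i, f i ∈ Set.range val) (T : Finset ι)
    (hT : ∀ i, f i ≠ 0 → i ∈ T) (hTS : T.card ≤ S) :
    ∃ g : Fin S → ι × β, sparseFun val g = f := by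
  classical
  obtain ⟨T', hTT', hcard⟩ := Finset.exists_superset_card_eq hTS hS
  choose c hc using hf
  let e : Fin S ≃ T' := (Fin.castOrderIso hcard.symm).toEquiv.trans T'.equivFin.symm
  refine ⟨fun t => (e t, c (e t)), funext fun i => ?_⟩
  unfold sparseFun
  split_ifs with h
  · have := h.choose_spec
    simp only at this
    rw [hc, this]
  · by_contra hi
    exact h ⟨e.symm ⟨i, hTT' (hT i (Ne.symm hi))⟩, by simp⟩

/-- The entry of a network at layer `i.1`, row `i.2.1` and column `i.2.2`; the bias is
stored in column `W`, and entries outside of the network are `0`. -/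
def ReLUNet.entry {d : ℕ} (Φ : ReLUNet d) (W : ℕ) (i : ℕ × ℕ × ℕ) : ℝ :=
  if i.1 < Φ.depth then
    if hj : i.2.1 < Φ.width (i.1 + 1) then
      if i.2.2 = W then Φ.b i.1 ⟨i.2.1, hj⟩
      else if hk : i.2.2 < Φ.width i.1 then Φ.A i.1 ⟨i.2.1, hj⟩ ⟨i.2.2, hk⟩ else 0
    else 0
  else 0

lemma ReLUNet.exists_support_entry {d : ℕ} (Φ : ReLUNet d) (W : ℕ) :
    ∃ T : Finset (ℕ × ℕ × ℕ), (∀ i, Φ.entry W i ≠ 0 → i ∈ T) ∧ T.card ≤ Φ.connectivity := by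
  classical
  refine ⟨(Finset.range Φ.depth).biUnion fun i =>
    (Finset.univ.filter fun jk : Fin (Φ.width (i + 1)) × Fin (Φ.width i) =>
        Φ.A i jk.1 jk.2 ≠ 0).image (fun jk => (i, (jk.1 : ℕ), (jk.2 : ℕ))) ∪
      (Finset.univ.filter fun j : Fin (Φ.width (i + 1)) => Φ.b i j ≠ 0).image
        (fun j : Fin (Φ.width (i + 1)) => (i, (j : ℕ), W)), ?_, ?_⟩
  · rintro ⟨i, j, k⟩ h
    unfold entry at h
    split_ifs at h with hi hj hk hk'
    · refine Finset.mem_biUnion.2 ⟨i, Finset.mem_range.2 hi, Finset.mem_union_right _ ?_⟩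
      exact Finset.mem_image.2 ⟨⟨j, hj⟩, by simpa using h, by simp_all⟩
    · refine Finset.mem_biUnion.2 ⟨i, Finset.mem_range.2 hi, Finset.mem_union_left _ ?_⟩
      exact Finset.mem_image.2 ⟨(⟨j, hj⟩, ⟨k, hk'⟩), by simpa using h, by simp_all⟩
    all_goals exact absurd rfl h
  · refine Finset.card_biUnion_le.trans ?_
    unfold connectivity
    refine Finset.sum_le_sum fun i _ => (Finset.card_union_le _ _).trans ?_
    refine add_le_add (Finset.card_image_le.trans (le_of_eq ?_))
      (Finset.card_image_le.trans (le_of_eq ?_)) <;> rfl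

/-- The function computed at depth `n.1 + 1` with entries `z` bounded by a box. -/
def boxRealization (d L W : ℕ) (z : Fin L × Fin W × Fin (W + 1) → ℝ) (n : ℕ)
    (x : Fin d → ℝ) : ℝ :=
  flatEval (fun _ => W)
    (fun i j k => if h : i < L ∧ j < W ∧ k < W then
      z (⟨i, h.1⟩, ⟨j, h.2.1⟩, ⟨k, h.2.2.trans (Nat.lt_succ_self W)⟩) else 0)
    (fun i j => if h : i < L ∧ j < W then z (⟨i, h.1⟩, ⟨j, h.2⟩, Fin.last W) else 0) x n 0

lemma ReLUNet.realization_eq_boxRealization {d L W : ℕ} (Φ : ReLUNet d) (hW : Φ.widthLe W)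
    (hL : Φ.depth ≤ L) :
    Φ.realization = boxRealization d L W (fun i => Φ.entry W (i.1, i.2.1, i.2.2)) Φ.depth := by
  funext x
  unfold realization boxRealization
  rw [Φ.forward_eq_flatEval (w := fun _ => W)
    (a := fun i j k => if i < L ∧ j < W ∧ k < W then Φ.entry W (i, j, k) else 0)
    (b := fun i j => if i < L ∧ j < W then Φ.entry W (i, j, W) else 0) _ _ _ _ x _ le_rfl]
  · simp
  · exact fun i hi => hW i hi.le
  · intro i hi j k
    have h1 := j.2.trans_le (hW (i + 1) hi)
    have h2 := k.2.trans_le (hW i hi.le)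
    simp [entry, hi, h1, h2, hi.trans_le hL, h2.ne]
  · intro i hi j k h1 h2
    simp [entry, h2.ne, h1.not_gt]
  · intro i hi j
    have h1 := j.2.trans_le (hW (i + 1) hi)
    simp [entry, hi, h1, hi.trans_le hL]

instance isProbabilityMeasure_restrict_unitCube (d : ℕ) :
    IsProbabilityMeasure (volume.restrict (unitCube d)) := by
  constructor
  rw [Measure.restrict_apply_univ, unitCube, volume_pi, Measure.pi_pi]
  simp

lemma cubeDist_le_of_forall {d : ℕ} (p : ℝ≥0∞) {f g : (Fin d → ℝ) → ℝ} {ε : ℝ}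
    (h : ∀ x ∈ unitCube d, |f x - g x| ≤ ε) : cubeDist d p f g ≤ ENNReal.ofReal ε := by
  have hm : MeasurableSet (unitCube d) := MeasurableSet.univ_pi fun _ => measurableSet_Icc
  refine (eLpNorm_le_of_ae_bound (C := ε) ?_).trans ?_
  · filter_upwards [ae_restrict_mem hm] with x hx
    simpa using h x hx
  · simp

/-- A finite internal cover obtained by rounding the weights. -/
lemma coveringNumber_RclassSparse_le {d W L s : ℕ} {B ε : ℝ} (p : ℝ≥0∞)
    (hL : 0 < L) (hB : 1 ≤ B) (hε : 0 < ε) :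
    coveringNumber (ENNReal.ofReal ε) (RclassSparse d W L B s) (cubeDist d p) ≤
      ((L * (L * (W * (W + 1)) * (2 * ⌊B / (ε / (L * ((W + 1) * B) ^ L))⌋₊ + 1)) ^
        min s (L * (W * (W + 1))) : ℕ) : ℕ∞) := by
  classical
  set δ : ℝ := ε / (L * (((W : ℝ) + 1) * B) ^ L) with hδdef
  have hL' : (0 : ℝ) < L := by exact_mod_cast hL
  have hT1 : 1 ≤ ((W : ℝ) + 1) * B := by
    have : (0 : ℝ) ≤ W := Nat.cast_nonneg W
    nlinarith
  have hTpos : 0 < (((W : ℝ) + 1) * B) ^ L := by positivity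
  have hδ : 0 < δ := by positivity
  set Q := ⌊B / δ⌋₊ with hQ
  set S := min s (L * (W * (W + 1))) with hS
  let val : Fin (2 * Q + 1) → ℝ := fun c => δ * ((c : ℝ) - Q)
  have hval0 : (0 : ℝ) ∈ Set.range val := ⟨⟨Q, by omega⟩, by simp [val]⟩
  have hgrid : ∀ v, ∃ y, |v| ≤ B → |v - y| ≤ δ ∧ |y| ≤ |v| ∧ y ∈ Set.range val := by
    intro v
    by_cases hv : |v| ≤ B
    · obtain ⟨c, h1, h2⟩ := exists_grid_approx hδ v hv
      exact ⟨val c, fun _ => ⟨h1, h2, c, rfl⟩⟩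
    · exact ⟨0, fun h => absurd h hv⟩
  choose q hq using hgrid
  have hq0 : q 0 = 0 := by
    have := (hq 0 (by simpa using by linarith)).2.1
    simpa using this
  let dec : Fin L × (Fin S → (Fin L × Fin W × Fin (W + 1)) × Fin (2 * Q + 1)) →
      (Fin d → ℝ) → ℝ := fun c => boxRealization d L W (sparseFun val c.2) (c.1 + 1)
  let C : Finset ((Fin d → ℝ) → ℝ) :=
    (Finset.univ.image dec).filter (· ∈ RclassSparse d W L B s)
  have hcard : C.card ≤ L * (L * (W * (W + 1)) * (2 * Q + 1)) ^ S := by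
    refine (Finset.card_filter_le _ _).trans (Finset.card_image_le.trans (le_of_eq ?_))
    simp [Finset.card_univ]
  refine le_trans (sInf_le ⟨C, ?_, ?_, rfl⟩) (by exact_mod_cast hcard)
  · intro f hf
    exact (Finset.mem_filter.1 hf).2
  · rintro _ ⟨Φ, hΦW, hΦL, hΦB, hΦs, rfl⟩
    have hΨB : (Φ.mapWeights q).magLe B := fun i hi =>
      ⟨fun j k => ((hq _ ((hΦB i hi).1 j k)).2.1).trans ((hΦB i hi).1 j k),
        fun j => ((hq _ ((hΦB i hi).2 j)).2.1).trans ((hΦB i hi).2 j)⟩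
    have hΨs : (Φ.mapWeights q).connectivity ≤ s :=
      (Φ.connectivity_mapWeights_le hq0).trans hΦs
    have hmem : (Φ.mapWeights q).realization ∈ RclassSparse d W L B s :=
      ⟨Φ.mapWeights q, hΦW, hΦL, hΨB, hΨs, rfl⟩
    refine ⟨(Φ.mapWeights q).realization, Finset.mem_filter.2 ⟨?_, hmem⟩, ?_⟩
    · obtain ⟨T, hT, hTc⟩ := (Φ.mapWeights q).exists_support_entry W
      let T' : Finset (Fin L × Fin W × Fin (W + 1)) :=
        Finset.univ.filter fun i => ((i.1 : ℕ), (i.2.1 : ℕ), (i.2.2 : ℕ)) ∈ T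
      have hT' : T'.card ≤ T.card := by
        refine Finset.card_le_card_of_injOn
          (fun i => ((i.1 : ℕ), (i.2.1 : ℕ), (i.2.2 : ℕ))) (fun i hi => ?_) ?_
        · exact (Finset.mem_filter.1 hi).2
        · rintro ⟨i1, i2, i3⟩ _ ⟨j1, j2, j3⟩ _ h
          simpa [Fin.ext_iff] using h
      have hT'2 : T'.card ≤ L * (W * (W + 1)) := by
        refine (Finset.card_le_univ _).trans (le_of_eq ?_)
        simp
      have hrange : ∀ i, (Φ.mapWeights q).entry W i ∈ Set.range val := fun i => by
        unfold ReLUNet.entry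
        split_ifs with hi hj hk hk'
        · exact (hq _ ((hΦB _ hi).2 _)).2.2
        · exact (hq _ ((hΦB _ hi).1 _ _)).2.2
        all_goals exact hval0
      obtain ⟨g, hg⟩ := exists_sparseFun_eq (S := S) (by simp [hS]) val
        (fun i : Fin L × Fin W × Fin (W + 1) =>
          (Φ.mapWeights q).entry W (i.1, i.2.1, i.2.2)) (fun i => hrange _) T'
        (fun i hi => Finset.mem_filter.2 ⟨Finset.mem_univ _, hT _ hi⟩)
        (le_min (hT'.trans (hTc.trans hΨs)) hT'2)
      refine Finset.mem_image.2 ⟨(⟨Φ.depth - 1, by have := Φ.depth_pos; omega⟩, g),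
        Finset.mem_univ _, ?_⟩
      rw [(Φ.mapWeights q).realization_eq_boxRealization hΦW hΦL]
      simp only [dec, hg]
      rw [Nat.sub_add_cancel Φ.depth_pos]
    · refine cubeDist_le_of_forall p fun x hx => ?_
      have hx' : ∀ k, |x k| ≤ 1 := fun k => by
        have := hx k (Set.mem_univ k)
        exact abs_le.2 ⟨by linarith [this.1], this.2⟩
      refine ((Φ.forward_bounds q hB hδ.le hΦW hΦB
        (fun v hv => ⟨(hq v hv).1, (hq v hv).2.1⟩) _ (fun k => hx' _) Φ.depth le_rfl).2
        (Fin.cast Φ.width_out.symm 0)).trans ?_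
      have hd : (Φ.depth : ℝ) ≤ L := by exact_mod_cast hΦL
      calc (Φ.depth : ℝ) * δ * (((W : ℝ) + 1) * B) ^ Φ.depth
          ≤ L * δ * (((W : ℝ) + 1) * B) ^ L := by gcongr
        _ = ε := by rw [hδdef]; field_simp

lemma elog2_le_of_le {m : ℕ∞} {n : ℕ} (hn : 0 < n) (h : m ≤ n) :
    elog2 m ≤ ENNReal.ofReal (Real.logb 2 n) := by
  lift m to ℕ using ne_top_of_le_ne_top (ENat.natCast_ne_top n) h
  rw [elog2, if_neg (ENat.natCast_ne_top m), ENat.toNat_natCast]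
  refine ENNReal.ofReal_le_ofReal ?_
  have hmn : m ≤ n := by exact_mod_cast h
  rcases Nat.eq_zero_or_pos m with rfl | hm
  · simpa using Real.logb_nonneg (by norm_num) (by exact_mod_cast hn : (1 : ℝ) ≤ n)
  · exact Real.logb_le_logb_of_le (by norm_num) (by exact_mod_cast hm) (by exact_mod_cast hmn)

lemma le_elog2_of_le {m : ℕ∞} {n : ℕ} (hn : 0 < n) (h : (n : ℕ∞) ≤ m) :
    ENNReal.ofReal (Real.logb 2 n) ≤ elog2 m := by
  rw [elog2]
  split_ifs with hm
  · exact le_top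
  · lift m to ℕ using hm
    have hmn : n ≤ m := by exact_mod_cast h
    rw [ENat.toNat_natCast]
    exact ENNReal.ofReal_le_ofReal (Real.logb_le_logb_of_le (by norm_num) (by exact_mod_cast hn)
      (by exact_mod_cast hmn))

lemma logb_card_codes_le {W L s : ℕ} {B ε : ℝ} (hW : 0 < W) (hL : 0 < L) (hs : 0 < s)
    (hB : 1 ≤ B) (hε : 0 < ε) (hε2 : ε < 1 / 2) :
    Real.logb 2 ((L * (L * (W * (W + 1)) * (2 * ⌊B / (ε / (L * ((W + 1) * B) ^ L))⌋₊ + 1)) ^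
        min s (L * (W * (W + 1))) : ℕ) : ℝ) ≤
      16 * min (s : ℝ) ((W : ℝ) ^ 2 * L) * Real.logb 2 (((W : ℝ) + 1) ^ L * B ^ L / ε) := by
  set Q := ⌊B / (ε / (L * ((W + 1) * B) ^ L))⌋₊ with hQ
  set S := min s (L * (W * (W + 1))) with hS
  set X : ℝ := ((W : ℝ) + 1) ^ L * B ^ L / ε with hX
  have hW1 : (1 : ℝ) ≤ W := by exact_mod_cast hW
  have hL1 : (1 : ℝ) ≤ L := by exact_mod_cast hL
  have hS1 : 1 ≤ S := le_min hs (Nat.succ_le_of_lt (by positivity))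
  have hBL : B ≤ B ^ L := le_self_pow₀ hB hL.ne'
  have hWL : (W : ℝ) + 1 ≤ ((W : ℝ) + 1) ^ L := le_self_pow₀ (by linarith) hL.ne'
  have h2L : (L : ℝ) ≤ ((W : ℝ) + 1) ^ L := by
    refine le_trans (by exact_mod_cast Nat.lt_two_pow_self.le : (L : ℝ) ≤ 2 ^ L) ?_
    gcongr; linarith
  have hprod : ∀ u v : ℝ, 0 ≤ u → u ≤ ((W : ℝ) + 1) ^ L → 0 ≤ v → v ≤ B ^ L →
      2 * (u * v) ≤ X := by
    intro u v hu hu' hv hv'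
    rw [hX, le_div_iff₀ hε]
    have h1 : u * v ≤ ((W : ℝ) + 1) ^ L * B ^ L := mul_le_mul hu' hv' hv (by positivity)
    have h0 : 0 ≤ u * v := by positivity
    nlinarith
  have hXL : (L : ℝ) ≤ X := by
    have := hprod L 1 (by linarith) h2L (by norm_num) (hB.trans hBL); linarith
  have hXW : (W : ℝ) + 1 ≤ X := by
    have := hprod (W + 1) 1 (by linarith) hWL (by norm_num) (hB.trans hBL); linarith
  have hXB : B ≤ X := by
    have := hprod 1 B (by norm_num) (by linarith) (by linarith) hBL; linarith
  have hX4 : 4 ≤ X := by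
    have := hprod (W + 1) 1 (by linarith) hWL (by norm_num) (hB.trans hBL); linarith
  have hQX : (2 * Q + 1 : ℝ) ≤ X ^ 4 := by
    have h1 : (Q : ℝ) ≤ B * L * X := by
      refine (Nat.floor_le (by positivity)).trans (le_of_eq ?_)
      rw [hX, mul_pow]; field_simp
    have h2 : B * L ≤ X / 2 := by
      have := hprod L B (by linarith) h2L (by linarith) hBL; linarith
    have h3 : B * L * X ≤ X / 2 * X := by gcongr
    nlinarith [sq_nonneg (X ^ 2 - 1), sq_nonneg X]
  have hbase : ((L * (W * (W + 1)) * (2 * Q + 1) : ℕ) : ℝ) ≤ X ^ 7 := by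
    push_cast
    calc (L : ℝ) * (W * (W + 1)) * (2 * Q + 1) ≤ X * (X * X) * X ^ 4 := by
          gcongr; linarith
      _ = X ^ 7 := by ring
  have hlogX : 0 ≤ Real.logb 2 X := Real.logb_nonneg (by norm_num) (by linarith)
  have htotal : ((L * (L * (W * (W + 1)) * (2 * Q + 1)) ^ S : ℕ) : ℝ) ≤ X ^ (1 + 7 * S) := by
    rw [pow_add, pow_mul, pow_one, Nat.cast_mul, Nat.cast_pow]
    gcongr
  have hSmin : (S : ℝ) ≤ 2 * min (s : ℝ) ((W : ℝ) ^ 2 * L) := by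
    rw [mul_min_of_nonneg _ _ (by norm_num)]
    refine le_min ?_ ?_
    · have : (S : ℝ) ≤ s := by exact_mod_cast min_le_left _ _
      have : (0 : ℝ) ≤ s := Nat.cast_nonneg s
      linarith
    · have : (S : ℝ) ≤ L * (W * (W + 1)) := by exact_mod_cast min_le_right _ _
      have h3 : (L : ℝ) * (W * (W + 1)) ≤ L * (W * (W + W)) := by gcongr
      linarith
  calc _ ≤ Real.logb 2 (X ^ (1 + 7 * S)) := by
        refine Real.logb_le_logb_of_le (by norm_num) ?_ htotal
        have : 0 < L * (L * (W * (W + 1)) * (2 * Q + 1)) ^ S := by positivity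
        exact_mod_cast this
    _ = (1 + 7 * S) * Real.logb 2 X := by rw [Real.logb_pow]; push_cast; ring
    _ ≤ _ := by
        refine mul_le_mul_of_nonneg_right ?_ hlogX
        have : (1 : ℝ) ≤ S := by exact_mod_cast hS1
        linarith

/-- The network with layer widths `w` and weights given by families indexed by natural numbers. -/
def ReLUNet.ofFlat {d n : ℕ} (hn : 0 < n) (w : ℕ → ℕ) (a : ℕ → ℕ → ℕ → ℝ) (b : ℕ → ℕ → ℝ)
    (h0 : w 0 = d) (h1 : w n = 1) : ReLUNet d where
  depth := n
  depth_pos := hn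
  width := w
  width_in := h0
  width_out := h1
  A i j k := a i j k
  b i j := b i j

lemma ReLUNet.connectivity_le {d V : ℕ} (Φ : ReLUNet d) (h : Φ.widthLe V) :
    Φ.connectivity ≤ Φ.depth * (V * V + V) := by
  classical
  unfold connectivity
  refine (Finset.sum_le_card_nsmul _ _ (V * V + V) fun i hi => ?_).trans (by simp)
  have hi' := Finset.mem_range.1 hi
  refine add_le_add ((Finset.card_le_univ _).trans ?_) ((Finset.card_le_univ _).trans ?_)
  · rw [Fintype.card_prod, Fintype.card_fin, Fintype.card_fin]
    exact Nat.mul_le_mul (h _ hi') (h _ hi'.le)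
  · rw [Fintype.card_fin]
    exact h _ hi'

/-- The functions `F k`, `k : ι`, are on the unit cube the outputs of the `n`-th layer, after
activation, of a network with widths at most `V` and weights at most `B`. -/
def Computes (d V : ℕ) (B : ℝ) (n : ℕ) (ι : Type) (F : (Fin d → ℝ) → ι → ℝ) : Prop :=
  ∃ (w : ℕ → ℕ) (a : ℕ → ℕ → ℕ → ℝ) (b : ℕ → ℕ → ℝ) (e : ι ≃ Fin (w n)),
    w 0 = d ∧ (∀ i ≤ n, w i ≤ V) ∧ (∀ i j k, |a i j k| ≤ B) ∧ (∀ i j, |b i j| ≤ B) ∧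
    ∀ x ∈ unitCube d, ∀ k,
      (if n = 0 then flatEval w a b x n (e k) else max (flatEval w a b x n (e k)) 0) = F x k

lemma Computes.input {d V : ℕ} {B : ℝ} (hB : 0 ≤ B) (hd : d ≤ V) :
    Computes d V B 0 (Fin d) fun x => x :=
  ⟨fun _ => d, 0, 0, Equiv.refl _, rfl, fun _ _ => hd, by simpa using hB, by simpa using hB,
    fun x _ k => by simp [flatEval]⟩

lemma exists_flat_succ {d V n : ℕ} {B : ℝ} {ι κ : Type} [Fintype ι] [Fintype κ]
    {F : (Fin d → ℝ) → ι → ℝ} (hF : Computes d V B n ι F) (hB : 0 ≤ B)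
    (hκ : Fintype.card κ ≤ V) (A : κ → ι → ℝ) (c : κ → ℝ) (hA : ∀ j k, |A j k| ≤ B)
    (hc : ∀ j, |c j| ≤ B) :
    ∃ (w : ℕ → ℕ) (a : ℕ → ℕ → ℕ → ℝ) (b : ℕ → ℕ → ℝ) (e : κ ≃ Fin (w (n + 1))),
      w 0 = d ∧ (∀ i ≤ n + 1, w i ≤ V) ∧ (∀ i j k, |a i j k| ≤ B) ∧ (∀ i j, |b i j| ≤ B) ∧
      ∀ x ∈ unitCube d, ∀ k,
        flatEval w a b x (n + 1) (e k) = (∑ l, A k l * F x l) + c k := by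
  obtain ⟨w, a, b, e, h0, hw, ha, hb, hE⟩ := hF
  let w' := Function.update w (n + 1) (Fintype.card κ)
  have hwn : w' (n + 1) = Fintype.card κ := Function.update_self ..
  have hwn' : w' n = w n := Function.update_of_ne (by omega) ..
  let e' : κ ≃ Fin (w' (n + 1)) := (Fintype.equivFin κ).trans (finCongr hwn.symm)
  let a' := Function.update a n fun j k =>
    if h : j < w' (n + 1) ∧ k < w n then A (e'.symm ⟨j, h.1⟩) (e.symm ⟨k, h.2⟩) else 0
  let b' := Function.update b n fun j =>
    if h : j < w' (n + 1) then c (e'.symm ⟨j, h⟩) else 0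
  refine ⟨w', a', b', e', ?_, ?_, ?_, ?_, ?_⟩
  · rw [← h0]
    exact Function.update_of_ne (by omega) ..
  · intro i hi
    rcases Nat.lt_or_eq_of_le hi with hi | rfl
    · rw [show w' i = w i from Function.update_of_ne (by omega) ..]
      exact hw i (by omega)
    · rwa [hwn]
  · intro i j k
    by_cases hi : i = n
    · subst hi
      simp only [a', Function.update_self]
      split_ifs
      · exact hA _ _
      · simpa using hB
    · simp only [a', Function.update_of_ne hi, ha]
  · intro i j
    by_cases hi : i = n
    · subst hi
      simp only [b', Function.update_self]
      split_ifs
      · exact hc _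
      · simpa using hB
    · simp only [b', Function.update_of_ne hi, hb]
  · intro x hx k
    have hcongr : ∀ l, flatEval w' a' b' x n l = flatEval w a b x n l := fun l =>
      flatEval_congr x n (fun i hi => ⟨Function.update_of_ne (by omega) ..,
        Function.update_of_ne (by omega) .., Function.update_of_ne (by omega) ..⟩) l
    rw [flatEval, hwn', Finset.sum_range, ← e.sum_comp]
    congr 1
    · refine Finset.sum_congr rfl fun l _ => ?_
      rw [hcongr, hE x hx l]
      simp [a']
    · simp [b']

lemma Computes.succ {d V n : ℕ} {B : ℝ} {ι κ : Type} [Fintype ι] [Fintype κ]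
    {F : (Fin d → ℝ) → ι → ℝ} (hF : Computes d V B n ι F) (hB : 0 ≤ B)
    (hκ : Fintype.card κ ≤ V) (A : κ → ι → ℝ) (c : κ → ℝ) (hA : ∀ j k, |A j k| ≤ B)
    (hc : ∀ j, |c j| ≤ B) (G : (Fin d → ℝ) → κ → ℝ)
    (hG : ∀ x ∈ unitCube d, ∀ k, max ((∑ l, A k l * F x l) + c k) 0 = G x k) :
    Computes d V B (n + 1) κ G := by
  obtain ⟨w, a, b, e, h0, hw, ha, hb, hE⟩ := exists_flat_succ hF hB hκ A c hA hc
  refine ⟨w, a, b, e, h0, hw, ha, hb, fun x hx k => ?_⟩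
  rw [if_neg (Nat.succ_ne_zero n), hE x hx k, hG x hx k]

/-- Closing a partial network with an affine output layer. -/
lemma Computes.exists_mem {d V W L s n : ℕ} {B : ℝ} {ι : Type} [Fintype ι]
    {F : (Fin d → ℝ) → ι → ℝ} (hF : Computes d V B n ι F) (hB : 0 ≤ B) (hV : 0 < V)
    (hVW : V ≤ W) (hn : n + 1 ≤ L) (hs : L * (V * V + V) ≤ s) (A : ι → ℝ)
    (hA : ∀ k, |A k| ≤ B) :
    ∃ f ∈ RclassSparse d W L B s, ∀ x ∈ unitCube d, f x = ∑ k, A k * F x k := by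
  obtain ⟨w, a, b, e, h0, hw, ha, hb, hE⟩ := exists_flat_succ hF hB (κ := Unit) (by rwa [Fintype.card_unit])
    (fun _ => A) 0 (fun _ => hA) (by simpa using hB)
  have h1 : w (n + 1) = 1 := by simpa using (Fintype.card_congr e).symm
  let Φ : ReLUNet d := .ofFlat (Nat.succ_pos n) w a b h0 h1
  have hΦV : Φ.widthLe V := hw
  refine ⟨Φ.realization, ⟨Φ, fun i hi => (hΦV i hi).trans hVW, hn,
    fun i _ => ⟨fun j k => ha _ _ _, fun j => hb _ _⟩,
    (Φ.connectivity_le hΦV).trans ((Nat.mul_le_mul_right _ hn).trans hs), rfl⟩, fun x hx => ?_⟩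
  unfold ReLUNet.realization
  rw [Φ.forward_eq_flatEval (w := w) (a := a) (b := b) (fun _ _ => le_rfl)
    (fun _ _ _ _ => rfl) (fun i _ j k h1 h2 => absurd h2 h1.not_gt) (fun _ _ _ => rfl) x _ le_rfl]
  have := hE x hx ()
  simp only [Pi.zero_apply, add_zero] at this
  rw [← this]
  congr 1
  have : ((e ()) : ℕ) < 1 := (e ()).2.trans_eq h1
  simp only [Fin.val_cast, Fin.val_zero]
  omega

/-- The tent of height `r` supported on `[0, 2 * r]`. -/
def tent (r y : ℝ) : ℝ := max y 0 - 2 * max (y - r) 0 + max (y - 2 * r) 0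

/-- A row of thresholded combinations of tents. -/
def tentRow {K : ℕ} (r : ℝ) (α τ : Fin K → ℝ) (θ : Fin K → Fin K → ℝ) (t : ℝ) : ℝ :=
  ∑ j, max (∑ k, θ j k * tent r (t - α k) - τ j) 0

lemma tentRow_nonneg {K : ℕ} (r : ℝ) (α τ : Fin K → ℝ) (θ : Fin K → Fin K → ℝ) (t : ℝ) :
    0 ≤ tentRow r α τ θ t :=
  Finset.sum_nonneg fun _ _ => le_max_right _ _

lemma Computes.add_tentRow {d V n K : ℕ} {B r : ℝ} (hd : 0 < d) {G : ℝ → ℝ}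
    (hF : Computes d V B n (Fin 2) fun x => ![x ⟨0, hd⟩, G (x ⟨0, hd⟩)])
    (hG : ∀ t, 0 ≤ G t) (hB : 1 ≤ B) (hV : 3 * K + 2 ≤ V) (hr : 0 ≤ r)
    {α τ : Fin K → ℝ} {θ : Fin K → Fin K → ℝ} (hα : ∀ k, 0 ≤ α k ∧ α k + 2 * r ≤ 1)
    (hτ : ∀ j, |τ j| ≤ 1) (hθ : ∀ j k, |θ j k| ≤ 1 / 2) :
    Computes d V B (n + 3) (Fin 2)
      fun x => ![x ⟨0, hd⟩, G (x ⟨0, hd⟩) + tentRow r α τ θ (x ⟨0, hd⟩)] := by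
  have hB0 : 0 ≤ B := by linarith
  have ht : ∀ x ∈ unitCube d, 0 ≤ x ⟨0, hd⟩ := fun x hx => (hx _ (Set.mem_univ _)).1
  have h1 : Computes d V B (n + 1) (Fin 2 ⊕ Fin K × Fin 3) fun x =>
      Sum.elim ![x ⟨0, hd⟩, G (x ⟨0, hd⟩)]
        fun p => max (x ⟨0, hd⟩ - α p.1 - (p.2 : ℝ) * r) 0 := by
    refine hF.succ hB0 (by simp; omega)
      (Sum.elim (fun i l => if i = l then 1 else 0) fun _ l => if l = 0 then 1 else 0)
      (Sum.elim 0 fun p => -(α p.1 + (p.2 : ℝ) * r)) ?_ ?_ _ fun x hx k => ?_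
    · rintro (i | p) l <;> simp only [Sum.elim_inl, Sum.elim_inr] <;> split_ifs <;> simp <;>
        linarith
    · rintro (i | ⟨k, i⟩)
      · simpa using hB0
      · have h3 : ((i : ℕ) : ℝ) ≤ 2 := by exact_mod_cast (by omega : (i : ℕ) ≤ 2)
        have := hα k
        simp only [Sum.elim_inr, abs_neg]
        rw [abs_of_nonneg (by have := this.1; positivity)]
        nlinarith
    · rcases k with i | ⟨k, i⟩
      · fin_cases i <;> simp [ht x hx, hG]
      · simp [sub_eq_add_neg]
        congr 1
        ring
  have h2 : Computes d V B (n + 2) (Fin 2 ⊕ Fin K) fun x =>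
      Sum.elim ![x ⟨0, hd⟩, G (x ⟨0, hd⟩)]
        fun j => max (∑ k, θ j k * tent r (x ⟨0, hd⟩ - α k) - τ j) 0 := by
    refine h1.succ hB0 (by simp; omega)
      (Sum.elim (fun i => Sum.elim (fun l => if i = l then 1 else 0) 0)
        fun j => Sum.elim 0 fun p => θ j p.1 * ![1, -2, 1] p.2)
      (Sum.elim 0 fun j => -τ j) ?_ ?_ _ fun x hx k => ?_
    · rintro (i | j) (l | ⟨k, l⟩)
      · simp only [Sum.elim_inl]; split_ifs <;> simp <;> linarith
      · simpa using hB0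
      · simpa using hB0
      · have := hθ j k
        have := abs_nonneg (θ j k)
        fin_cases l <;> simp [abs_mul] <;> linarith
    · rintro (i | j)
      · simpa using hB0
      · simpa using (hτ j).trans hB
    · rcases k with i | j
      · fin_cases i <;> simp [ht x hx, hG]
      · simp only [Fintype.sum_sum_type, Sum.elim_inr, Sum.elim_inl, Pi.zero_apply, zero_mul,
          Finset.sum_const_zero, zero_add, Fintype.sum_prod_type, ← sub_eq_add_neg]
        congr 2
        refine Finset.sum_congr rfl fun k _ => ?_
        simp [Fin.sum_univ_three, tent]
        ring
  refine h2.succ hB0 (by simp; omega)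
    (fun i => Sum.elim (fun l => if i = l then 1 else 0) fun _ => if i = 1 then 1 else 0)
    0 ?_ (by simpa using hB0) _ fun x hx k => ?_
  · rintro i (l | l) <;> simp only [Sum.elim_inl, Sum.elim_inr] <;> split_ifs <;> simp <;>
      linarith
  · fin_cases k
    · simp [ht x hx]
    · simpa [tentRow] using add_nonneg (hG (x ⟨0, hd⟩)) (tentRow_nonneg r α τ θ (x ⟨0, hd⟩))

lemma Computes.sum_tentRow {d V K : ℕ} {B r : ℝ} (hd : 0 < d) (hdV : d ≤ V) (hB : 1 ≤ B)
    (hV : 3 * K + 2 ≤ V) (hr : 0 ≤ r) {α : ℕ → Fin K → ℝ} {τ : Fin K → ℝ}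
    {θ : ℕ → Fin K → Fin K → ℝ} (hτ : ∀ j, |τ j| ≤ 1) (hθ : ∀ l j k, |θ l j k| ≤ 1 / 2) (m : ℕ)
    (hα : ∀ l < m, ∀ k, 0 ≤ α l k ∧ α l k + 2 * r ≤ 1) :
    Computes d V B (1 + 3 * m) (Fin 2) fun x =>
      ![x ⟨0, hd⟩, ∑ l ∈ Finset.range m, tentRow r (α l) τ (θ l) (x ⟨0, hd⟩)] := by
  induction m with
  | zero =>
    refine (Computes.input (by linarith) hdV).succ (by linarith) (by simp; omega)
      (fun i l => if i = 0 ∧ l = ⟨0, hd⟩ then 1 else 0) 0 ?_ (by simp; linarith) _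
      fun x hx k => ?_
    · intro j k; split_ifs <;> simp <;> linarith
    · have := (hx ⟨0, hd⟩ (Set.mem_univ _)).1
      fin_cases k <;> simp [this]
  | succ m ih =>
    simp only [Finset.sum_range_succ]
    exact (ih fun l hl => hα l (by omega)).add_tentRow hd
      (G := fun t => ∑ l ∈ Finset.range m, tentRow r (α l) τ (θ l) t)
      (fun t => Finset.sum_nonneg fun _ _ => tentRow_nonneg ..) hB hV hr (hα m (by omega)) hτ
      (hθ m)

/-- Every layer of `K` identical neurons multiplies the output by `B * K`. -/
lemma Computes.amplify {d V n K : ℕ} {B : ℝ} {h G : (Fin d → ℝ) → ℝ}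
    (hF : Computes d V B n (Fin 2) fun x => ![h x, G x]) (hG : ∀ x, 0 ≤ G x) (hB : 1 ≤ B)
    (hV : K ≤ V) (q : ℕ) :
    Computes d V B (n + 1 + q) (Fin K) fun x _ => (B * K) ^ q * G x := by
  induction q with
  | zero =>
    refine hF.succ (by linarith : (0 : ℝ) ≤ B) (by simpa) (fun _ l => if l = 1 then 1 else 0) 0 ?_
      (fun _ => by simp; linarith) _ fun x hx k => ?_
    · intro j k; split_ifs <;> simp <;> linarith
    · simp [hG]
  | succ q ih =>
    refine ih.succ (by linarith : (0 : ℝ) ≤ B) (by simpa) (fun _ _ => B) 0 ?_ (fun _ => by simp; linarith) _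
      fun x hx k => ?_
    · intro j k; rw [abs_of_nonneg (by linarith)]
    · have h1 := hG x
      have h2 : 0 ≤ B := by linarith
      simp only [Finset.sum_const, Finset.card_univ, Fintype.card_fin, nsmul_eq_mul, Pi.zero_apply,
        add_zero]
      rw [max_eq_left (by positivity)]
      ring

/-- An amplified sum of rows of tents is realized by a sparse network. -/
lemma exists_mem_RclassSparse_eq_tentRow {d V W L s K m q : ℕ} {B r : ℝ} (hd : 0 < d)
    (hdV : d ≤ V) (hB : 1 ≤ B) (hV : 3 * K + 2 ≤ V) (hVW : V ≤ W) (hL : 3 * m + q + 3 ≤ L)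
    (hs : L * (V * V + V) ≤ s) (hr : 0 ≤ r) {α : ℕ → Fin K → ℝ} {τ : Fin K → ℝ}
    {θ : ℕ → Fin K → Fin K → ℝ} (hτ : ∀ j, |τ j| ≤ 1) (hθ : ∀ l j k, |θ l j k| ≤ 1 / 2)
    (hα : ∀ l < m, ∀ k, 0 ≤ α l k ∧ α l k + 2 * r ≤ 1) :
    ∃ f ∈ RclassSparse d W L B s, ∀ x ∈ unitCube d, f x =
      (B * K) ^ (q + 1) * ∑ l ∈ Finset.range m, tentRow r (α l) τ (θ l) (x ⟨0, hd⟩) := by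
  obtain ⟨f, hf, hfx⟩ := ((Computes.sum_tentRow hd hdV hB hV hr hτ hθ m hα).amplify
    (fun x => Finset.sum_nonneg fun _ _ => tentRow_nonneg ..) hB (K := K) (by omega) q).exists_mem
    (by linarith) (by omega) hVW (by omega) hs (fun _ => B)
    (fun _ => by rw [abs_of_nonneg (by linarith)])
  refine ⟨f, hf, fun x hx => (hfx x hx).trans ?_⟩
  simp only [Finset.sum_const, Finset.card_univ, Fintype.card_fin, nsmul_eq_mul]
  ring

lemma tent_of_nonpos {r y : ℝ} (hr : 0 ≤ r) (hy : y ≤ 0) : tent r y = 0 := by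
  rw [tent, max_eq_right hy, max_eq_right (by linarith), max_eq_right (by linarith)]; ring

lemma tent_of_ge {r y : ℝ} (hr : 0 ≤ r) (hy : 2 * r ≤ y) : tent r y = 0 := by
  rw [tent, max_eq_left (by linarith), max_eq_left (by linarith), max_eq_left (by linarith)]; ring

lemma tent_of_mem {r y : ℝ} (h0 : 0 ≤ y) (hy : y ≤ r) : tent r y = y := by
  rw [tent, max_eq_left h0, max_eq_right (by linarith), max_eq_right (by linarith)]; ring

/-- The left endpoint of the `k`-th tent in the `l`-th row. -/
def tentStart (K : ℕ) (r : ℝ) (l : ℕ) (k : Fin K) : ℝ := 2 * r * ((l * K + k : ℕ) : ℝ)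

/-- The threshold of the `j`-th neuron. -/
def tentThreshold (K : ℕ) (r : ℝ) (j : Fin K) : ℝ := r * (1 / 2 + (j : ℝ) / (4 * K)) / 2

/-- The coefficients encoding `z`. -/
def tentCoef {m K : ℕ} (M : ℕ) (z : Fin m → Fin K → Fin K → Fin M) (l : ℕ) (j k : Fin K) : ℝ :=
  if h : l < m then 1 / 2 - ((z ⟨l, h⟩ j k : ℕ) : ℝ) / (16 * K * M) else 0

lemma tentCoef_bounds {m K M : ℕ} (hM : 0 < M) (z : Fin m → Fin K → Fin K → Fin M)
    {l : ℕ} (hl : l < m) (j k : Fin K) :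
    1 / 2 - 1 / (16 * K) ≤ tentCoef M z l j k ∧ tentCoef M z l j k ≤ 1 / 2 := by
  have hK : (0 : ℝ) < K := by exact_mod_cast j.pos
  have hM' : (0 : ℝ) < M := by exact_mod_cast hM
  have hz : ((z ⟨l, hl⟩ j k : ℕ) : ℝ) ≤ M := by exact_mod_cast (z ⟨l, hl⟩ j k).2.le
  rw [tentCoef, dif_pos hl]
  constructor
  · have : ((z ⟨l, hl⟩ j k : ℕ) : ℝ) / (16 * K * M) ≤ 1 / (16 * K) := by
      rw [div_le_div_iff₀ (by positivity) (by positivity)]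
      nlinarith
    linarith
  · have : 0 ≤ ((z ⟨l, hl⟩ j k : ℕ) : ℝ) / (16 * K * M) := by positivity
    linarith

lemma abs_tentCoef_le {m K M : ℕ} (hM : 0 < M) (z : Fin m → Fin K → Fin K → Fin M)
    (l : ℕ) (j k : Fin K) : |tentCoef M z l j k| ≤ 1 / 2 := by
  by_cases hl : l < m
  · obtain ⟨h1, h2⟩ := tentCoef_bounds hM z hl j k
    have hK : (1 : ℝ) ≤ K := by exact_mod_cast j.pos
    have : 1 / (16 * (K : ℝ)) ≤ 1 := by rw [div_le_one (by positivity)]; linarith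
    exact abs_le.2 ⟨by linarith, h2⟩
  · rw [tentCoef, dif_neg hl]; norm_num

lemma tent_sub_tentStart {K : ℕ} {r y : ℝ} (h0 : 0 ≤ y) (hy : y ≤ r) (l l₀ : ℕ) (k k₀ : Fin K) :
    tent r (tentStart K r l₀ k₀ + y - tentStart K r l k) =
      if l = l₀ ∧ k = k₀ then y else 0 := by
  have hr : 0 ≤ r := h0.trans hy
  split_ifs with h
  · obtain ⟨rfl, rfl⟩ := h
    rw [add_sub_cancel_left, tent_of_mem h0 hy]
  · have hne : l₀ * K + k₀ ≠ l * K + k := by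
      intro he
      have hk : (k₀ : ℕ) = k := by
        have := congrArg (· % K) he
        simpa [Nat.add_mod, Nat.mod_eq_of_lt] using this
      have hl : l₀ = l :=
        Nat.eq_of_mul_eq_mul_right k.pos (by omega : l₀ * K = l * K)
      exact h ⟨hl.symm, Fin.ext hk.symm⟩
    rcases Nat.lt_or_gt_of_ne hne with hlt | hgt
    · have : ((l₀ * K + k₀ : ℕ) : ℝ) + 1 ≤ (l * K + k : ℕ) := by exact_mod_cast hlt
      refine tent_of_nonpos hr ?_
      simp only [tentStart]
      nlinarith
    · have : ((l * K + k : ℕ) : ℝ) + 1 ≤ (l₀ * K + k₀ : ℕ) := by exact_mod_cast hgt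
      refine tent_of_ge hr ?_
      simp only [tentStart]
      nlinarith

/-- On the rising half of a tent only one row is present. -/
lemma sum_tentRow_eq {K m : ℕ} {r y : ℝ} (h0 : 0 ≤ y) (hy : y ≤ r)
    (θ : ℕ → Fin K → Fin K → ℝ) {l₀ : ℕ} (hl₀ : l₀ < m) (k₀ : Fin K) :
    ∑ l ∈ Finset.range m, tentRow r (tentStart K r l) (tentThreshold K r) (θ l)
        (tentStart K r l₀ k₀ + y) =
      ∑ j, max (θ l₀ j k₀ * y - tentThreshold K r j) 0 := by
  have hr : 0 ≤ r := h0.trans hy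
  rw [Finset.sum_eq_single_of_mem l₀ (Finset.mem_range.2 hl₀)]
  · simp [tentRow, tent_sub_tentStart h0 hy]
  · intro l _ hl
    refine Finset.sum_eq_zero fun j _ => max_eq_right ?_
    have : 0 ≤ tentThreshold K r j := by unfold tentThreshold; positivity
    simpa [tent_sub_tentStart h0 hy, hl] using this

/-- Distinct codes give functions that differ on an interval, located just after the first
breakpoint at which the codes differ. -/
lemma exists_interval_sep {m K M : ℕ} (hM : 0 < M) {r : ℝ} (hr : 0 < r)
    {z z' : Fin m → Fin K → Fin K → Fin M} (hz : z ≠ z') :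
    ∃ l < m, ∃ k : Fin K, ∃ t₁ t₂ : ℝ, t₂ - t₁ = r / (8 * K) ∧ tentStart K r l k ≤ t₁ ∧
      t₂ ≤ tentStart K r l k + r ∧ ∀ t ∈ Set.Icc t₁ t₂, r / (32 * K * M) ≤
      |(∑ l ∈ Finset.range m, tentRow r (tentStart K r l) (tentThreshold K r) (tentCoef M z l) t)
        - ∑ l ∈ Finset.range m,
          tentRow r (tentStart K r l) (tentThreshold K r) (tentCoef M z' l) t| := by
  classical
  obtain ⟨l, hl⟩ := Function.ne_iff.1 hz
  obtain ⟨j₁, hj₁⟩ := Function.ne_iff.1 hl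
  obtain ⟨k, hk⟩ := Function.ne_iff.1 hj₁
  obtain ⟨j, hj, hmin⟩ := (Finset.univ.filter fun j => z l j k ≠ z' l j k).exists_minimal
    ⟨j₁, Finset.mem_filter.2 ⟨Finset.mem_univ _, hk⟩⟩
  have hj := (Finset.mem_filter.1 hj).2
  have heq : ∀ i < j, z l i k = z' l i k := by
    intro i hi
    by_contra hne
    exact absurd (hmin (Finset.mem_filter.2 ⟨Finset.mem_univ _, hne⟩) hi.le) (not_le.2 hi)
  have hK : (1 : ℝ) ≤ K := by exact_mod_cast j.pos
  have hM' : (0 : ℝ) < M := by exact_mod_cast hM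
  have hjK : (j : ℝ) + 1 ≤ K := by exact_mod_cast j.2
  set g : ℝ := 1 / (8 * K) with hg
  have hg0 : 0 < g := by positivity
  have hg8 : g ≤ 1 / 8 := by
    rw [hg, div_le_div_iff₀ (by positivity) (by norm_num)]; linarith
  have hthr : ∀ i : Fin K, tentThreshold K r i = r * (1 / 2 + 2 * g * i) / 2 := by
    intro i; rw [tentThreshold, hg]; field_simp; ring
  have hgK : g * K = 1 / 8 := by rw [hg]; field_simp
  have hjg : 2 * g * (j : ℝ) + 2 * g ≤ 1 / 4 := by nlinarith
  have hjg0 : 0 ≤ 2 * g * (j : ℝ) := by positivity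
  have hbd : ∀ (c : Fin m → Fin K → Fin K → Fin M) (i : Fin K),
      1 / 2 - g / 2 ≤ tentCoef M c l i k ∧ tentCoef M c l i k ≤ 1 / 2 := by
    intro c i
    have := tentCoef_bounds hM c l.2 i k
    have h2 : 1 / (16 * (K : ℝ)) = g / 2 := by rw [hg]; field_simp; norm_num
    rwa [h2] at this
  refine ⟨l, l.2, k, tentStart K r l k + r * (1 / 2 + 2 * g * j + g),
    tentStart K r l k + r * (1 / 2 + 2 * g * j + 2 * g), ?_, ?_, ?_, ?_⟩
  · rw [hg]; field_simp; ring
  · have : 0 ≤ r * (1 / 2 + 2 * g * j + g) := by positivity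
    linarith
  · nlinarith
  · rintro t ⟨ht₁, ht₂⟩
    obtain ⟨u, rfl⟩ : ∃ u, t = tentStart K r l k + r * u :=
      ⟨(t - tentStart K r l k) / r, by field_simp; ring⟩
    have hu₁ : 1 / 2 + 2 * g * j + g ≤ u := by
      have := le_of_add_le_add_left ht₁
      exact le_of_mul_le_mul_left this hr
    have hu₂ : u ≤ 1 / 2 + 2 * g * j + 2 * g := by
      have := le_of_add_le_add_left ht₂
      exact le_of_mul_le_mul_left this hr
    have hy0 : 0 ≤ r * u := by have : 0 ≤ u := by linarith
                               positivity
    have hy1 : r * u ≤ r := by nlinarith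
    rw [sum_tentRow_eq hy0 hy1 _ l.2, sum_tentRow_eq hy0 hy1 _ l.2, ← Finset.sum_sub_distrib,
      Finset.sum_eq_single j]
    · have hact : ∀ c : Fin m → Fin K → Fin K → Fin M,
          max (tentCoef M c l j k * (r * u) - tentThreshold K r j) 0
            = tentCoef M c l j k * (r * u) - tentThreshold K r j := by
        intro c
        refine max_eq_left ?_
        rw [hthr]
        have h1 := (hbd c j).1
        have h2 : (1 / 2 - g / 2) * (1 / 2 + 2 * g * j + g) ≤ tentCoef M c l j k * u :=
          mul_le_mul h1 hu₁ (by positivity) (by linarith)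
        have h3 : (1 / 2 + 2 * g * j) / 2 ≤ (1 / 2 - g / 2) * (1 / 2 + 2 * g * j + g) := by
          nlinarith
        nlinarith
      rw [hact, hact]
      have hd : (1 : ℝ) / (16 * K * M) ≤ |tentCoef M z l j k - tentCoef M z' l j k| := by
        rw [tentCoef, tentCoef, dif_pos l.2, dif_pos l.2]
        have h1 : (1 : ℝ) ≤ |((z' l j k : ℕ) : ℝ) - ((z l j k : ℕ) : ℝ)| := by
          have : ((z' l j k : ℕ) : ℤ) - ((z l j k : ℕ) : ℤ) ≠ 0 := by
            intro h
            exact hj (Fin.ext (by omega))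
          have := Int.one_le_abs this
          exact_mod_cast this
        have h2 : (1 / 2 - ((z l j k : ℕ) : ℝ) / (16 * K * M)) -
            (1 / 2 - ((z' l j k : ℕ) : ℝ) / (16 * K * M))
            = (((z' l j k : ℕ) : ℝ) - ((z l j k : ℕ) : ℝ)) / (16 * K * M) := by ring
        rw [Fin.eta, h2, abs_div, abs_of_pos (by positivity : (0 : ℝ) < 16 * K * M)]
        gcongr
      rw [sub_sub_sub_cancel_right, ← sub_mul, abs_mul, abs_of_nonneg hy0]
      calc r / (32 * K * M) = 1 / (16 * K * M) * (r * (1 / 2)) := by field_simp; norm_num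
        _ ≤ _ := by gcongr; linarith
    · intro i _ hij
      rcases lt_or_gt_of_ne hij with hlt | hgt
      · simp [tentCoef, heq i hlt]
      · have hi : (j : ℝ) + 1 ≤ i := by exact_mod_cast hgt
        have hin : ∀ c : Fin m → Fin K → Fin K → Fin M,
            max (tentCoef M c l i k * (r * u) - tentThreshold K r i) 0 = 0 := by
          intro c
          refine max_eq_right ?_
          rw [hthr]
          have h1 := (hbd c i).2
          have h2 : tentCoef M c l i k * (r * u) ≤ 1 / 2 * (r * u) := by gcongr
          have h3 : u ≤ 1 / 2 + 2 * g * i := by nlinarith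
          nlinarith
        rw [hin, hin, sub_zero]
    · simp

lemma continuous_of_mem_RclassSparse {d W L s : ℕ} {B : ℝ} {f : (Fin d → ℝ) → ℝ}
    (hf : f ∈ RclassSparse d W L B s) : Continuous f := by
  obtain ⟨Φ, -, -, -, -, rfl⟩ := hf
  exact Φ.continuous_realization

lemma le_cubeDist_one {d : ℕ} (hd : 0 < d) {f g : (Fin d → ℝ) → ℝ} {c t₁ t₂ : ℝ} (hc : 0 ≤ c)
    (h₁ : 0 ≤ t₁) (h₂ : t₂ ≤ 1)
    (h : ∀ x ∈ unitCube d, x ⟨0, hd⟩ ∈ Set.Icc t₁ t₂ → c ≤ |f x - g x|) :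
    ENNReal.ofReal (c * (t₂ - t₁)) ≤ cubeDist d 1 f g := by
  set I : Fin d → Set ℝ := fun i => if i = ⟨0, hd⟩ then Set.Icc t₁ t₂ else Set.Icc 0 1 with hI
  have hsub : Set.univ.pi I ⊆ unitCube d := by
    refine Set.pi_mono fun i _ => ?_
    simp only [hI]
    split_ifs
    · exact Set.Icc_subset_Icc h₁ h₂
    · exact le_rfl
  have hImeas : MeasurableSet (Set.univ.pi I) := by
    refine MeasurableSet.univ_pi fun i => ?_
    simp only [hI]
    split_ifs <;> exact measurableSet_Icc
  have hvol : volume (Set.univ.pi I) = ENNReal.ofReal (t₂ - t₁) := by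
    rw [volume_pi, Measure.pi_pi, Finset.prod_eq_single ⟨0, hd⟩]
    · simp [hI]
    · intro i _ hi
      simp [hI, hi]
    · simp
  rw [cubeDist, eLpNorm_one_eq_lintegral_enorm]
  calc ENNReal.ofReal (c * (t₂ - t₁))
      = ∫⁻ _ in Set.univ.pi I, ENNReal.ofReal c := by
        rw [setLIntegral_const, hvol, ENNReal.ofReal_mul hc]
    _ ≤ ∫⁻ x in Set.univ.pi I, ‖(f - g) x‖ₑ := by
        refine setLIntegral_mono' hImeas fun x hx => ?_
        rw [← ofReal_norm, Pi.sub_apply, Real.norm_eq_abs]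
        refine ENNReal.ofReal_le_ofReal (h x (hsub hx) ?_)
        simpa [hI] using hx ⟨0, hd⟩ (Set.mem_univ _)
    _ ≤ _ := lintegral_mono_set hsub

/-- A family that is `2ε`-separated in `L¹` bounds the covering numbers from below. -/
lemma card_le_coveringNumber {d W L s : ℕ} {B : ℝ} {ε : ℝ≥0∞} {p : ℝ≥0∞} (hp : 1 ≤ p)
    {ι : Type*} [Fintype ι] (F : ι → (Fin d → ℝ) → ℝ) (hF : ∀ i, F i ∈ RclassSparse d W L B s)
    (hsep : ∀ i j, i ≠ j → ε + ε < cubeDist d 1 (F i) (F j)) :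
    (Fintype.card ι : ℕ∞) ≤ coveringNumber ε (RclassSparse d W L B s) (cubeDist d p) := by
  refine le_sInf ?_
  rintro _ ⟨C, hC, hcov, rfl⟩
  choose c hcC hc using fun i => hcov (F i) (hF i)
  have hone : ∀ i, cubeDist d 1 (F i) (c i) ≤ ε := fun i =>
    (eLpNorm_le_eLpNorm_of_exponent_le hp
      ((continuous_of_mem_RclassSparse (hF i)).sub
        (continuous_of_mem_RclassSparse (hC (hcC i)))).aestronglyMeasurable).trans (hc i)
  have hinj : Function.Injective c := by
    intro i j hij
    by_contra hne
    refine (hsep i j hne).not_ge ?_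
    have hFi := continuous_of_mem_RclassSparse (hF i)
    have hFj := continuous_of_mem_RclassSparse (hF j)
    have hci := continuous_of_mem_RclassSparse (hC (hcC i))
    calc cubeDist d 1 (F i) (F j)
        = eLpNorm ((F i - c i) - (F j - c i)) 1 (volume.restrict (unitCube d)) := by
          rw [sub_sub_sub_cancel_right, cubeDist]
      _ ≤ cubeDist d 1 (F i) (c i) + cubeDist d 1 (F j) (c i) :=
          eLpNorm_sub_le (hFi.sub hci).aestronglyMeasurable (hFj.sub hci).aestronglyMeasurable
            le_rfl
      _ ≤ ε + ε := add_le_add (hone i) (hij ▸ hone j)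
  have : Fintype.card ι ≤ C.card := by
    rw [← Finset.card_univ]
    exact Finset.card_le_card_of_injOn c (fun i _ => hcC i) hinj.injOn
  exact_mod_cast this

/-- The amplification dominates the losses of the tent construction. -/
lemma amplification_bound {m K : ℕ} {B : ℝ} (hm : 5 ≤ m) (hK : 5 ≤ K) (hB : 1 ≤ B) :
    16384 * (m : ℝ) ^ 2 * K ^ 4 < (B * K) ^ (5 * m) := by
  have h1 : 128 * (m : ℝ) < 25 ^ m := by
    induction m, hm using Nat.le_induction with
    | base => norm_num
    | succ n hn ih =>
      rw [pow_succ]; push_cast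
      have : (5 : ℝ) ≤ n := by exact_mod_cast hn
      linarith
  have hK' : (5 : ℝ) ≤ K := by exact_mod_cast hK
  have h2 : (128 * (m : ℝ)) ^ 2 < (25 ^ m) ^ 2 := by gcongr
  calc 16384 * (m : ℝ) ^ 2 * (K : ℝ) ^ 4 = (128 * (m : ℝ)) ^ 2 * (K : ℝ) ^ 4 := by ring
    _ < (25 ^ m) ^ 2 * (K : ℝ) ^ 4 := by gcongr
    _ = (5 : ℝ) ^ (4 * m) * (K : ℝ) ^ 4 := by
      rw [← pow_mul, show (25 : ℝ) = 5 ^ 2 by norm_num, ← pow_mul]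
      congr 2; ring
    _ ≤ (K : ℝ) ^ (4 * m) * (K : ℝ) ^ m := by gcongr <;> linarith
    _ = (K : ℝ) ^ (5 * m) := by rw [← pow_add]; congr 1; ring
    _ ≤ _ := by gcongr; nlinarith

/-- Covering number lower bound in terms of the size of the tent construction. -/
lemma pow_le_coveringNumber {d V W L s K m : ℕ} {B ε : ℝ} {p : ℝ≥0∞} (hp : 1 ≤ p) (hd : 0 < d)
    (hdV : d ≤ V) (hB : 1 ≤ B) (hV : 3 * K + 2 ≤ V) (hVW : V ≤ W) (hm : 5 ≤ m) (hK : 5 ≤ K)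
    (hL : 12 * m ≤ L) (hs : L * (V * V + V) ≤ s) (hε : 0 < ε) (hε1 : ε < 1) :
    ((⌈(B * K) ^ m / ε⌉₊ ^ (m * (K * K)) : ℕ) : ℕ∞) ≤
      coveringNumber (ENNReal.ofReal ε) (RclassSparse d W L B s) (cubeDist d p) := by
  set M := ⌈(B * K) ^ m / ε⌉₊ with hMdef
  have hK' : (5 : ℝ) ≤ K := by exact_mod_cast hK
  have hm' : (5 : ℝ) ≤ m := by exact_mod_cast hm
  have hBK : 1 ≤ B * K := by nlinarith
  have hBKm : 1 ≤ (B * K) ^ m := one_le_pow₀ hBK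
  have hM1 : 1 ≤ (B * K) ^ m / ε := by rw [le_div_iff₀ hε]; linarith
  have hM : 0 < M := Nat.ceil_pos.2 (by positivity)
  have hM' : (0 : ℝ) < M := by exact_mod_cast hM
  have hMle : (M : ℝ) ≤ 2 * ((B * K) ^ m / ε) := by
    have := Nat.ceil_lt_add_one (a := (B * K) ^ m / ε) (by positivity)
    linarith
  set r : ℝ := 1 / (2 * m * K) with hr
  have hr0 : 0 < r := by positivity
  have hr1 : r ≤ 1 := by
    rw [hr, div_le_one (by positivity)]; nlinarith
  have hα : ∀ l < m, ∀ k : Fin K, 0 ≤ tentStart K r l k ∧ tentStart K r l k + 2 * r ≤ 1 := by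
    intro l hl k
    refine ⟨by unfold tentStart; positivity, ?_⟩
    have h1 : l * K + k + 1 ≤ m * K := by
      calc l * K + k + 1 ≤ l * K + K := by omega
        _ = (l + 1) * K := by ring
        _ ≤ m * K := Nat.mul_le_mul_right _ hl
    have h2 : ((l * K + k : ℕ) : ℝ) + 1 ≤ m * K := by exact_mod_cast h1
    have h3 : 2 * r * (m * K) = 1 := by rw [hr]; field_simp
    have h4 : 2 * r * (((l * K + k : ℕ) : ℝ) + 1) ≤ 2 * r * (m * K) := by gcongr
    rw [tentStart]
    linarith
  have hτ : ∀ j : Fin K, |tentThreshold K r j| ≤ 1 := by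
    intro j
    have hj : (j : ℝ) / (4 * K) ≤ 1 := by
      rw [div_le_one (by positivity)]
      have : (j : ℝ) ≤ K := by exact_mod_cast j.2.le
      linarith
    rw [tentThreshold, abs_of_nonneg (by positivity)]
    have : 0 ≤ (j : ℝ) / (4 * K) := by positivity
    nlinarith
  choose F hF hFx using fun z : Fin m → Fin K → Fin K → Fin M =>
    exists_mem_RclassSparse_eq_tentRow (W := W) (q := 6 * m) hd hdV hB hV hVW (by omega) hs
      hr0.le hτ (abs_tentCoef_le hM z) hα
  have hcard : Fintype.card (Fin m → Fin K → Fin K → Fin M) = M ^ (m * (K * K)) := by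
    simp only [Fintype.card_fun, Fintype.card_fin, ← pow_mul]
    congr 1; ring
  rw [← hcard]
  refine card_le_coveringNumber hp F hF fun z z' hz => ?_
  obtain ⟨l, hl, k, t₁, t₂, h12, ht₁, ht₂, hsep⟩ := exists_interval_sep hM hr0 hz
  obtain ⟨hα0, hα1⟩ := hα l hl k
  refine lt_of_lt_of_le ?_ (le_cubeDist_one hd (t₁ := t₁) (t₂ := t₂)
    (c := (B * K) ^ (6 * m + 1) * (r / (32 * K * M))) (by positivity) (by linarith) (by linarith)
    fun x hx hxt => ?_)
  · rw [← ENNReal.ofReal_add hε.le hε.le, ENNReal.ofReal_lt_ofReal_iff_of_nonneg (by positivity),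
      h12]
    have h1 : (B * K) ^ (6 * m + 1) * (r / (32 * K * M)) * (r / (8 * K))
        = (B * K) ^ (6 * m + 1) / (1024 * m ^ 2 * K ^ 4 * M) := by
      rw [hr]; field_simp; norm_num
    rw [h1, lt_div_iff₀ (by positivity)]
    calc (ε + ε) * (1024 * m ^ 2 * K ^ 4 * M)
        ≤ (ε + ε) * (1024 * m ^ 2 * K ^ 4 * (2 * ((B * K) ^ m / ε))) := by gcongr
      _ = 4096 * m ^ 2 * K ^ 4 * (B * K) ^ m := by field_simp; ring
      _ ≤ 16384 * m ^ 2 * K ^ 4 * (B * K) ^ m := by gcongr; norm_num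
      _ < (B * K) ^ (5 * m) * (B * K) ^ m := by
        gcongr
        exact amplification_bound hm hK hB
      _ = (B * K) ^ (6 * m) := by rw [← pow_add]; congr 1; ring
      _ ≤ (B * K) ^ (6 * m + 1) := pow_le_pow_right₀ hBK (by omega)
  · rw [hFx z x hx, hFx z' x hx, ← mul_sub, abs_mul, abs_of_nonneg (by positivity)]
    gcongr
    exact hsep _ hxt

lemma lower_constant_bound {W L s K m R : ℕ} {B ε : ℝ} (hm : 5 ≤ m) (hK : 5 ≤ K)
    (hB : 1 ≤ B) (hε : 0 < ε) (hε1 : ε < 1) (hL : L ≤ 15 * m) (hR : R + 1 ≤ 15 * K)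
    (hmin : min (s : ℝ) ((W : ℝ) ^ 2 * L) ≤ (R : ℝ) ^ 2 * L) :
    1 / 151875 * min (s : ℝ) ((W : ℝ) ^ 2 * L) * Real.logb 2 (((R : ℝ) + 1) ^ L * B ^ L / ε) ≤
      Real.logb 2 ((⌈(B * K) ^ m / ε⌉₊ ^ (m * (K * K)) : ℕ) : ℝ) := by
  have hK' : (5 : ℝ) ≤ K := by exact_mod_cast hK
  have hm' : (5 : ℝ) ≤ m := by exact_mod_cast hm
  have hL' : (L : ℝ) ≤ 15 * m := by exact_mod_cast hL
  have hR' : (R : ℝ) + 1 ≤ 15 * K := by exact_mod_cast hR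
  have hR0 : (0 : ℝ) ≤ R := Nat.cast_nonneg R
  have hBK : 1 ≤ B * K := by nlinarith
  have hBKm : 1 ≤ (B * K) ^ m := one_le_pow₀ hBK
  have hM1 : 1 ≤ (B * K) ^ m / ε := by rw [le_div_iff₀ hε]; linarith
  have h1 : min (s : ℝ) ((W : ℝ) ^ 2 * L) ≤ 3375 * (m * (K * K)) := by
    calc _ ≤ (R : ℝ) ^ 2 * L := hmin
      _ ≤ (15 * K) ^ 2 * (15 * m) := by gcongr; linarith
      _ = _ := by ring
  have hRK : (R : ℝ) + 1 ≤ (K : ℝ) ^ 3 := by nlinarith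
  have h2 : ((R : ℝ) + 1) ^ L * B ^ L / ε ≤ ((B * K) ^ m / ε) ^ 45 := by
    have hεp : ε ^ 45 ≤ ε := pow_le_of_le_one hε.le hε1.le (by norm_num)
    rw [div_pow, ← pow_mul, ← mul_pow]
    calc (((R : ℝ) + 1) * B) ^ L / ε ≤ ((K : ℝ) ^ 3 * B ^ 3) ^ L / ε := by
          gcongr
          exact le_self_pow₀ hB (by norm_num)
      _ = (B * K) ^ (3 * L) / ε := by rw [← mul_pow, ← pow_mul, mul_comm (K : ℝ)]
      _ ≤ (B * K) ^ (m * 45) / ε := by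
          gcongr ?_ / _
          exact pow_le_pow_right₀ hBK (by omega)
      _ ≤ _ := by gcongr
  have hlog0 : 0 ≤ Real.logb 2 ((B * K) ^ m / ε) := Real.logb_nonneg (by norm_num) hM1
  have hlog : Real.logb 2 (((R : ℝ) + 1) ^ L * B ^ L / ε)
      ≤ 45 * Real.logb 2 ((B * K) ^ m / ε) := by
    refine (Real.logb_le_logb_of_le (by norm_num) (by positivity) h2).trans (le_of_eq ?_)
    rw [Real.logb_pow]; norm_num
  have hlogX0 : 0 ≤ Real.logb 2 (((R : ℝ) + 1) ^ L * B ^ L / ε) := by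
    have hX : 1 ≤ ((R : ℝ) + 1) ^ L * B ^ L :=
      one_le_mul_of_one_le_of_one_le (one_le_pow₀ (by linarith)) (one_le_pow₀ hB)
    refine Real.logb_nonneg (by norm_num) ?_
    rw [le_div_iff₀ hε]
    linarith
  calc _ ≤ 1 / 151875 * (3375 * (m * (K * K))) * (45 * Real.logb 2 ((B * K) ^ m / ε)) := by
        refine mul_le_mul ?_ hlog hlogX0 (by positivity)
        gcongr
    _ = (m * (K * K)) * Real.logb 2 ((B * K) ^ m / ε) := by ring
    _ ≤ (m * (K * K)) * Real.logb 2 (⌈(B * K) ^ m / ε⌉₊ : ℝ) := by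
        gcongr
        · norm_num
        · exact Nat.le_ceil _
    _ = _ := by rw [Nat.cast_pow, Real.logb_pow]; push_cast; ring
/-- Covering number upper and lower bounds for sparse ReLU networks
with uniformly bounded weights. -/
theorem covering_bounds_sparse_networks :
    (∃ C : ℝ, 0 < C ∧
      ∀ (p : ℝ≥0∞) (d W L s : ℕ) (B ε : ℝ),
        1 ≤ p → 0 < d → 0 < L → d ≤ W → W ≤ s → L ≤ s → 1 ≤ B →
        0 < ε → ε < 1 / 2 →
        elog2 (coveringNumber (ENNReal.ofReal ε) (RclassSparse d W L B s) (cubeDist d p))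
          ≤ ENNReal.ofReal
              (C * min (s : ℝ) ((W : ℝ) ^ 2 * L) *
                Real.logb 2 (((W : ℝ) + 1) ^ L * B ^ L / ε)))
    ∧ (∃ c D : ℝ, 0 < c ∧ 0 < D ∧
      ∀ (p : ℝ≥0∞) (d W L s : ℕ) (B ε : ℝ),
        1 ≤ p → 0 < d → d ≤ W → W ≤ s → L ≤ s → 1 ≤ B →
        60 ≤ W → 60 ≤ L → D * (d : ℝ) ^ 2 * L ≤ (s : ℝ) →
        0 < ε → ε < 1 / 4 →
        ENNReal.ofReal
            (c * min (s : ℝ) ((W : ℝ) ^ 2 * L) *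
              Real.logb 2
                (((min ⌈Real.sqrt ((s : ℝ) / L)⌉₊ W : ℕ) + 1 : ℝ) ^ L * B ^ L / ε))
          ≤ elog2
              (coveringNumber (ENNReal.ofReal ε) (RclassSparse d W L B s)
                (cubeDist d p))) := by
  refine ⟨⟨16, by norm_num, ?_⟩, 1 / 151875, 3600, by norm_num, by norm_num, ?_⟩
  · intro p d W L s B ε _ hd hL hdW hWs _ hB hε hε2
    have hW : 0 < W := hd.trans_le hdW
    refine (elog2_le_of_le (by positivity) (coveringNumber_RclassSparse_le p hL hB hε)).trans
      (ENNReal.ofReal_le_ofReal ?_)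
    exact logb_card_codes_le hW hL (hW.trans_le hWs) hB hε hε2
  · intro p d W L s B ε hp hd hdW _ _ hB hW hL hD hε hε4
    set R := min ⌈Real.sqrt ((s : ℝ) / L)⌉₊ W with hR
    have hL0 : (0 : ℝ) < L := by exact_mod_cast (by omega : 0 < L)
    have hd1 : (1 : ℝ) ≤ d := by exact_mod_cast hd
    set y : ℝ := Real.sqrt ((s : ℝ) / L) with hy
    have hy0 : 0 ≤ y := Real.sqrt_nonneg _
    have hysq : y ^ 2 * L = s := by
      rw [hy, Real.sq_sqrt (by positivity)]; field_simp
    have hyd : 60 * (d : ℝ) ≤ y := by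
      refine Real.le_sqrt_of_sq_le ?_
      rw [le_div_iff₀ hL0]
      linarith
    have hceil : (60 : ℕ) * d ≤ ⌈y⌉₊ := by
      exact_mod_cast (by push_cast; exact hyd.trans (Nat.le_ceil y) :
        ((60 * d : ℕ) : ℝ) ≤ (⌈y⌉₊ : ℝ))
    have hR60 : 60 ≤ R := le_min (by omega) hW
    have hRW : R ≤ W := min_le_right _ _
    have hRy : (R : ℝ) ≤ y + 1 :=
      (by exact_mod_cast min_le_left _ _ : (R : ℝ) ≤ (⌈y⌉₊ : ℝ)).trans
        (Nat.ceil_lt_add_one hy0).le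
    set K := R / 12 with hK
    set m := L / 12 with hm
    set V := max d (3 * K + 2) with hV
    have hVy : (V : ℝ) * V + V ≤ y ^ 2 := by
      have h1 : (V : ℝ) ≤ y / 3 + 1 / 3 := by
        have h3 : 3 * (3 * K + 2) ≤ R := by omega
        have h4 : 3 * (3 * (K : ℝ) + 2) ≤ R := by exact_mod_cast h3
        rw [hV]; push_cast
        exact max_le (by linarith) (by linarith)
      have h2 : (0 : ℝ) ≤ V := Nat.cast_nonneg V
      nlinarith
    have hs : L * (V * V + V) ≤ s := by
      have : (L : ℝ) * (V * V + V) ≤ s := by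
        rw [← hysq, mul_comm]
        gcongr
      exact_mod_cast this
    have hmin : min (s : ℝ) ((W : ℝ) ^ 2 * L) ≤ (R : ℝ) ^ 2 * L := by
      rcases min_choice ⌈y⌉₊ W with h | h
      · refine (min_le_left _ _).trans ?_
        rw [← hysq, hR, h]
        gcongr
        exact Nat.le_ceil y
      · refine (min_le_right _ _).trans (le_of_eq ?_)
        rw [hR, h]
    have hK5 : 5 ≤ K := by omega
    have hm5 : 5 ≤ m := by omega
    have hcover := pow_le_coveringNumber (W := W) (L := L) (s := s) hp hd (le_max_left d _) hB
      (le_max_right d (3 * K + 2)) (max_le hdW (by omega)) hm5 hK5 (by omega) hs hε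
      (by linarith)
    refine le_trans (ENNReal.ofReal_le_ofReal ?_) (le_elog2_of_le ?_ hcover)
    · exact lower_constant_bound hm5 hK5 hB hε (by linarith) (by omega) (by omega) hmin
    · have : 0 < (B * K) ^ m / ε := by positivity
      exact pow_pos (Nat.ceil_pos.2 this) _
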